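/- Let t ≥ 3 and let C₁ and C₂ be any two additive extended perfect codes with α ≠ 0 and binary length α+2β = 2^t, both of dual type (α,β;γ,δ). If δ = 1, then 2^(2^t−2t) ≤ η(C₁,C₂) ≤ 2^(2^t−t−1); if δ ≠ 1, then 2^(2^t−2t−1) ≤ η(C₁,C₂) ≤ 2^(2^t−t−1). -/

import Mathlib

open scoped BigOperators

/-- `Z2` is the ring of integers modulo 2. -/
abbrev Z2 : Type := ZMod 2

/-- `Z4` is the ring of integers modulo 4. -/
abbrev Z4 : Type := ZMod 4

/-- The ambient group `Z₂^α × Z₄^β` for additive codes. -/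
abbrev Amb (α β : ℕ) : Type := (Fin α → Z2) × (Fin β → Z4)

/-- The inner product on `Z₂^α × Z₄^β`:
`⟨u,v⟩ = 2·(Σᵢ ūᵢ·v̄ᵢ) + Σⱼ uⱼ·vⱼ ∈ Z₄`, where the bar denotes the lift `0 ↦ 0`, `1 ↦ 1`
of binary coordinates into `Z₄`. -/
def addInner {α β : ℕ} (u v : Amb α β) : Z4 :=
  2 * (∑ i, ((u.1 i).val : Z4) * ((v.1 i).val : Z4)) + ∑ j, u.2 j * v.2 j

lemma addInner_zero_left {α β : ℕ} (v : Amb α β) : addInner 0 v = 0 := by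
  simp [addInner]

lemma addInner_add_left {α β : ℕ} (u u' v : Amb α β) :
    addInner (u + u') v = addInner u v + addInner u' v := by
  have key : ∀ x x' y : Z2,
      (2 : Z4) * ((((x + x').val : ℕ) : Z4) * ((y.val : ℕ) : Z4)) =
        2 * (((x.val : ℕ) : Z4) * ((y.val : ℕ) : Z4)) +
          2 * (((x'.val : ℕ) : Z4) * ((y.val : ℕ) : Z4)) := by decide
  simp only [addInner, Prod.fst_add, Prod.snd_add, Pi.add_apply, add_mul,
    Finset.mul_sum, Finset.sum_add_distrib]
  rw [Finset.sum_congr rfl (fun i _ => key (u.1 i) (u'.1 i) (v.1 i)),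
    Finset.sum_add_distrib]
  ring

lemma addInner_neg_left {α β : ℕ} (u v : Amb α β) :
    addInner (-u) v = - addInner u v := by
  have hn : ∀ x : Z2, (-x) = x := by decide
  have key : ∀ S T : Z4, 2 * S + -T = -(2 * S + T) := by decide
  simp only [addInner, Prod.fst_neg, Prod.snd_neg, Pi.neg_apply, hn, neg_mul]
  rw [Finset.sum_neg_distrib]
  exact key _ _

/-- The additive dual `C^⊥ = {u : ⟨u,v⟩ = 0 for all v ∈ C}` of an additive code `C`. -/
def dualCode {α β : ℕ} (C : AddSubgroup (Amb α β)) : AddSubgroup (Amb α β) where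
  carrier := {u | ∀ v ∈ C, addInner u v = 0}
  zero_mem' := fun v _ => addInner_zero_left v
  add_mem' := by
    intro a b ha hb v hv
    rw [addInner_add_left, ha v hv, hb v hv, add_zero]
  neg_mem' := by
    intro a ha v hv
    rw [addInner_neg_left, ha v hv, neg_zero]

/-- An additive code `C ⊆ Z₂^α × Z₄^β` is of type `(α,β;γ,δ)` when it is isomorphic,
as an abelian group, to `Z₂^γ × Z₄^δ`; equivalently (which is how we state it),
`|C| = 2^(γ+2δ)` and the number of elements `x ∈ C` with `x + x = 0` is `2^(γ+δ)`. -/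
def isOfType {α β : ℕ} (C : AddSubgroup (Amb α β)) (γ δ : ℕ) : Prop :=
  Nat.card C = 2 ^ (γ + 2 * δ) ∧
    Nat.card {x : Amb α β // x ∈ C ∧ x + x = 0} = 2 ^ (γ + δ)

/-- An additive code `C` is of type `(α,β;γ,δ;κ)` when it is of type `(α,β;γ,δ)` and
`2^κ` is the cardinality of the image of `{x ∈ C : x + x = 0}` under the projection
onto the binary coordinates. -/
def isOfTypeK {α β : ℕ} (C : AddSubgroup (Amb α β)) (γ δ κ : ℕ) : Prop :=
  isOfType C γ δ ∧
    Nat.card ↥(Prod.fst '' {x : Amb α β | x ∈ C ∧ x + x = 0}) = 2 ^ κ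

/-- The Gray map on one quaternary coordinate:
`0 ↦ (0,0)`, `1 ↦ (0,1)`, `2 ↦ (1,1)`, `3 ↦ (1,0)`. -/
def grayPhi (y : Z4) : Z2 × Z2 :=
  if y = 0 then (0, 0) else if y = 1 then (0, 1) else if y = 2 then (1, 1) else (1, 0)

/-- The Gray map `Φ : Z₂^α × Z₄^β → Z₂^(α+2β)` (with index set `Fin α ⊕ Fin β × Fin 2`),
acting as the identity on the binary coordinates and as `grayPhi` coordinatewise on the
quaternary coordinates. -/
def grayMap {α β : ℕ} (u : Amb α β) : (Fin α ⊕ Fin β × Fin 2) → Z2 :=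
  Sum.elim (fun a => u.1 a)
    (fun b => if b.2 = 0 then (grayPhi (u.2 b.1)).1 else (grayPhi (u.2 b.1)).2)

/-- The minimum Hamming distance of a binary code `S` equals `d`. -/
def minDistEq {ι : Type} [Fintype ι] (S : Set (ι → Z2)) (d : ℕ) : Prop :=
  (∀ x ∈ S, ∀ y ∈ S, x ≠ y → d ≤ hammingDist x y) ∧
    ∃ x ∈ S, ∃ y ∈ S, x ≠ y ∧ hammingDist x y = d

/-- A quaternary linear perfect code of length `β = 2^(t-1)` (`t ≥ 3`): an additive
subgroup of `Z₄^β` whose Gray image has cardinality `2^(2β-t-1)` and minimum Hamming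
distance `4`. -/
def isQuatPerfect (t β : ℕ) (C : AddSubgroup (Amb 0 β)) : Prop :=
  3 ≤ t ∧ β = 2 ^ (t - 1) ∧
    Nat.card ↥(grayMap '' (C : Set (Amb 0 β))) = 2 ^ (2 * β - t - 1) ∧
    minDistEq (grayMap '' (C : Set (Amb 0 β))) 4

/-- An additive extended perfect code with `α ≠ 0` and binary length `α + 2β = 2^t`:
an additive subgroup of `Z₂^α × Z₄^β` with `α ≥ 1` whose Gray image has cardinality
`2^(2^t - t - 1)` and minimum Hamming distance `4`. -/
def isAddExtPerfect (t α β : ℕ) (C : AddSubgroup (Amb α β)) : Prop :=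
  1 ≤ α ∧ α + 2 * β = 2 ^ t ∧
    Nat.card ↥(grayMap '' (C : Set (Amb α β))) = 2 ^ (2 ^ t - t - 1) ∧
    minDistEq (grayMap '' (C : Set (Amb α β))) 4

section AmbientGroup

variable {α β : ℕ}

lemma card_amb (α β : ℕ) : Nat.card (Amb α β) = 2 ^ (α + 2 * β) := by
  rw [Nat.card_prod, Nat.card_fun, Nat.card_fun, Nat.card_zmod, Nat.card_zmod, Nat.card_fin,
    Nat.card_fin, pow_add, pow_mul]
  norm_num

/-- The vector with a single `1`, in a binary position. -/
def binUnit (i : Fin α) : Amb α β := (Pi.single i 1, 0)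

/-- The vector with a single `1`, in a quaternary position. -/
def quatUnit (j : Fin β) : Amb α β := (0, Pi.single j 1)

lemma addSubgroup_eq_top_of_units_mem (H : AddSubgroup (Amb α β))
    (hb : ∀ i, binUnit i ∈ H) (hq : ∀ j, quatUnit j ∈ H) (x : Amb α β) : x ∈ H := by
  have hx : x = ∑ i, (x.1 i).val • (binUnit i : Amb α β) +
      ∑ j, (x.2 j).val • (quatUnit j : Amb α β) := by
    refine Prod.ext ?_ ?_
    · ext k
      simp [binUnit, quatUnit, Prod.fst_sum, Finset.sum_apply, Pi.single_apply, -nsmul_eq_mul,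
        nsmul_one]
    · ext k
      simp [binUnit, quatUnit, Prod.snd_sum, Finset.sum_apply, Pi.single_apply, -nsmul_eq_mul,
        nsmul_one]
  rw [hx]
  exact H.add_mem (H.sum_mem fun i _ => H.nsmul_mem (hb i) _)
    (H.sum_mem fun j _ => H.nsmul_mem (hq j) _)

/-- Sum of the quaternary coordinates, modulo 2. -/
def quatParity : Amb α β →+ Z2 where
  toFun x := ∑ j, ZMod.castHom (by norm_num : 2 ∣ 4) Z2 (x.2 j)
  map_zero' := by simp
  map_add' x y := by simp only [Prod.snd_add, Pi.add_apply, map_add, Finset.sum_add_distrib]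

/-- Sum of all coordinates, modulo 2. -/
def parity : Amb α β →+ Z2 where
  toFun x := ∑ i, x.1 i + quatParity x
  map_zero' := by simp
  map_add' x y := by
    simp only [Prod.fst_add, Pi.add_apply, map_add, Finset.sum_add_distrib]
    ring

@[simp] lemma quatParity_binUnit (i : Fin α) : quatParity (binUnit i : Amb α β) = 0 := by
  simp [quatParity, binUnit]

@[simp] lemma quatParity_quatUnit (j : Fin β) : quatParity (quatUnit j : Amb α β) = 1 := by
  simp [quatParity, quatUnit, Pi.single_apply, apply_ite]

@[simp] lemma parity_binUnit (i : Fin α) : parity (binUnit i : Amb α β) = 1 := by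
  change ∑ k, (binUnit i : Amb α β).1 k + quatParity (binUnit i : Amb α β) = 1
  simp [binUnit, -quatParity_binUnit, quatParity]

@[simp] lemma parity_quatUnit (j : Fin β) : parity (quatUnit j : Amb α β) = 1 := by
  change ∑ k, (quatUnit j : Amb α β).1 k + quatParity (quatUnit j : Amb α β) = 1
  rw [quatParity_quatUnit]
  simp [quatUnit]

end AmbientGroup

section Weight

variable {α β : ℕ}

/-- The Lee weight, that is, the Hamming weight of the Gray image. -/
def leeWeight (x : Amb α β) : ℕ := hammingDist (grayMap x) (grayMap 0)

/-- The Lee weight of a single quaternary coordinate. -/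
def quatWeight (y : Z4) : ℕ := if y = 0 then 0 else if y = 2 then 2 else 1

lemma leeWeight_eq_sum (x : Amb α β) :
    leeWeight x = ∑ i, (x.1 i).val + ∑ j, quatWeight (x.2 j) := by
  have hb : ∀ a : Z2, (if a ≠ 0 then 1 else 0) = a.val := by decide
  have hq : ∀ y : Z4, (if (grayPhi y).1 ≠ (grayPhi 0).1 then 1 else 0) +
      (if (grayPhi y).2 ≠ (grayPhi 0).2 then 1 else 0) = quatWeight y := by decide
  rw [leeWeight, hammingDist, Finset.card_filter, Fintype.sum_sum_type, Fintype.sum_prod_type]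
  congr 1
  · exact Finset.sum_congr rfl fun i _ => hb _
  · refine Finset.sum_congr rfl fun j _ => ?_
    rw [Fin.sum_univ_two, ← hq]
    rfl

lemma leeWeight_add_le (x y : Amb α β) : leeWeight (x + y) ≤ leeWeight x + leeWeight y := by
  have hb : ∀ a b : Z2, (a + b).val ≤ a.val + b.val := by decide
  have hq : ∀ a b : Z4, quatWeight (a + b) ≤ quatWeight a + quatWeight b := by decide
  have h₁ := Finset.sum_le_sum fun i (_ : i ∈ Finset.univ) => hb (x.1 i) (y.1 i)
  have h₂ := Finset.sum_le_sum fun j (_ : j ∈ Finset.univ) => hq (x.2 j) (y.2 j)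
  rw [Finset.sum_add_distrib] at h₁ h₂
  simp only [leeWeight_eq_sum, Prod.fst_add, Prod.snd_add, Pi.add_apply]
  omega

lemma leeWeight_neg (x : Amb α β) : leeWeight (-x) = leeWeight x := by
  have hb : ∀ a : Z2, (-a).val = a.val := by decide
  have hq : ∀ a : Z4, quatWeight (-a) = quatWeight a := by decide
  simp only [leeWeight_eq_sum, Prod.fst_neg, Prod.snd_neg, Pi.neg_apply, hb, hq]

lemma leeWeight_binUnit (i : Fin α) : leeWeight (binUnit i : Amb α β) = 1 := by
  have : ∀ k, ((Pi.single i 1 : Fin α → Z2) k).val = if k = i then 1 else 0 := by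
    intro k
    rw [Pi.single_apply]
    split_ifs <;> rfl
  simp [leeWeight_eq_sum, binUnit, this, quatWeight]

lemma leeWeight_quatUnit (j : Fin β) : leeWeight (quatUnit j : Amb α β) = 1 := by
  have : ∀ k, quatWeight ((Pi.single j 1 : Fin β → Z4) k) = if k = j then 1 else 0 := by
    intro k
    rw [Pi.single_apply]
    split_ifs <;> rfl
  simp [leeWeight_eq_sum, quatUnit, this]

lemma grayMap_injective : Function.Injective (grayMap : Amb α β → _) := by
  have hq : ∀ y z : Z4, (grayPhi y).1 = (grayPhi z).1 → (grayPhi y).2 = (grayPhi z).2 → y = z := by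
    decide
  intro x y h
  refine Prod.ext (funext fun i => congrFun h (Sum.inl i)) (funext fun j => hq _ _ ?_ ?_)
  · exact congrFun h (Sum.inr (j, 0))
  · exact congrFun h (Sum.inr (j, 1))

/-- The vectors of Lee weight one, indexed by positions (with a sign for quaternary ones). -/
def unitVec : Fin α ⊕ Fin β × Bool → Amb α β :=
  Sum.elim binUnit fun p => if p.2 then quatUnit p.1 else -quatUnit p.1

lemma unitVec_injective : Function.Injective (unitVec : _ → Amb α β) := by
  have hs : ∀ (j k : Fin β) (a b : Z4), a ≠ 0 →
      (Pi.single j a : Fin β → Z4) = Pi.single k b → j = k ∧ a = b := by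
    intro j k a b ha h
    have h' := congrFun h j
    rw [Pi.single_eq_same, Pi.single_apply] at h'
    split_ifs at h' with hjk
    · exact ⟨hjk, h'⟩
    · exact absurd h' ha
  have hv : ∀ p : Fin β × Bool, (unitVec (Sum.inr p) : Amb α β) =
      (0, Pi.single p.1 (if p.2 then 1 else -1)) := by
    rintro ⟨j, b⟩
    cases b <;> simp [unitVec, quatUnit, Pi.single_neg]
  have hne : ∀ b : Bool, (if b then 1 else -1 : Z4) ≠ 0 := by decide
  have hinj : ∀ b c : Bool, (if b then 1 else -1 : Z4) = (if c then 1 else -1) → b = c := by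
    decide
  have hbq : ∀ (i : Fin α) (p : Fin β × Bool),
      (unitVec (Sum.inl i) : Amb α β) ≠ unitVec (Sum.inr p) := by
    intro i p h
    rw [hv] at h
    have := congrFun (congrArg Prod.fst h) i
    simp [unitVec, binUnit] at this
  rintro (i | p) (k | q) h
  · by_contra hik
    have h' := congrFun (congrArg Prod.fst h) i
    simp only [unitVec, binUnit, Sum.elim_inl, Pi.single_eq_same, Pi.single_apply] at h'
    split_ifs at h' with hc
    · exact hik (by rw [hc])
    · exact one_ne_zero h'
  · exact absurd h (hbq _ _)
  · exact absurd h.symm (hbq _ _)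
  · rw [hv, hv] at h
    obtain ⟨h₁, h₂⟩ := hs _ _ _ _ (hne _) (congrArg Prod.snd h)
    rw [Prod.ext h₁ (hinj _ _ h₂)]

lemma leeWeight_unitVec (i) : leeWeight (unitVec i : Amb α β) = 1 := by
  rcases i with i | ⟨j, b⟩
  · exact leeWeight_binUnit i
  · cases b
    · exact (leeWeight_neg _).trans (leeWeight_quatUnit j)
    · exact leeWeight_quatUnit j

lemma parity_unitVec (i) : parity (unitVec i : Amb α β) = 1 := by
  rcases i with i | ⟨j, b⟩
  · exact parity_binUnit i
  · cases b
    · simp only [unitVec, Sum.elim_inr, Bool.false_eq_true, if_false, map_neg, parity_quatUnit]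
      decide
    · exact parity_quatUnit j

lemma exists_unitVec_eq_neg (i) : ∃ k, (unitVec k : Amb α β) = -unitVec i := by
  rcases i with i | ⟨j, b⟩
  · refine ⟨Sum.inl i, Prod.ext (funext fun k => ?_) (by simp [unitVec, binUnit])⟩
    have : ∀ a : Z2, a = -a := by decide
    exact this _
  · exact ⟨Sum.inr (j, !b), by cases b <;> simp [unitVec]⟩

end Weight

section SumFree

variable {G : Type*} [AddCommGroup G] [Finite G]

/-- In a sum-free symmetric subset filling half of a finite group, translation by an element of
the subset exchanges the subset and its complement. -/
lemma add_mem_iff_notMem_of_sumFree {S : Set G} (hcard : Nat.card G = 2 * S.ncard)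
    (hneg : ∀ s ∈ S, -s ∈ S) (hsum : ∀ s ∈ S, ∀ s' ∈ S, s + s' ∉ S) {s : G} (hs : s ∈ S) (q : G) :
    q + s ∈ S ↔ q ∉ S := by
  have himage : (fun x => -s + x) '' S = Sᶜ := by
    refine Set.eq_of_subset_of_ncard_le ?_ ?_ (Set.toFinite _)
    · rintro _ ⟨x, hx, rfl⟩
      exact hsum _ (hneg s hs) x hx
    · rw [Set.ncard_image_of_injective _ (add_right_injective (-s))]
      have := Set.ncard_add_ncard_compl S
      omega
  refine ⟨fun h hq => hsum q hq s hs h, fun hq => ?_⟩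
  obtain ⟨x, hx, rfl⟩ : q ∈ (fun x => -s + x) '' S := himage ▸ hq
  simpa [add_comm] using hx

end SumFree

section PerfectCode

variable {t α β γ δ : ℕ} {C : AddSubgroup (Amb α β)}

lemma isAddExtPerfect.card (h : isAddExtPerfect t α β C) :
    Nat.card C = 2 ^ (2 ^ t - t - 1) := by
  rw [← h.2.2.1, Nat.card_image_of_injective grayMap_injective]
  rfl

lemma isAddExtPerfect.eq_zero_of_leeWeight_lt (h : isAddExtPerfect t α β C) {x : Amb α β}
    (hx : x ∈ C) (hw : leeWeight x < 4) : x = 0 := by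
  by_contra hne
  exact absurd (h.2.2.2.1 _ ⟨x, hx, rfl⟩ _ ⟨0, C.zero_mem, rfl⟩
    fun he => hne (grayMap_injective he)) (not_le.mpr hw)

lemma isAddExtPerfect.le_ker_parity (h : isAddExtPerfect t α β C) : C ≤ parity.ker := by
  classical
  let mk := QuotientAddGroup.mk' C
  have hmk : ∀ x, mk x = 0 ↔ x ∈ C := fun x => QuotientAddGroup.eq_zero_iff x
  let S : Set (Amb α β ⧸ C) := Set.range fun i => mk (unitVec i)
  have hinj : Function.Injective fun i => mk (unitVec i) := by
    intro i k hik
    have hmem : (unitVec i - unitVec k : Amb α β) ∈ C := by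
      rw [← hmk, map_sub, sub_eq_zero]
      exact hik
    refine unitVec_injective (sub_eq_zero.mp (h.eq_zero_of_leeWeight_lt hmem ?_))
    have := leeWeight_add_le (unitVec i : Amb α β) (-unitVec k)
    rw [leeWeight_neg, leeWeight_unitVec, leeWeight_unitVec, ← sub_eq_add_neg] at this
    omega
  have hS : S.ncard = 2 ^ t := by
    rw [← h.2.1, ← Nat.card_coe_set_eq, Nat.card_range_of_injective hinj]
    simp [Nat.card_eq_fintype_card]
    ring
  have hcard : Nat.card (Amb α β ⧸ C) = 2 * S.ncard := by
    have h₁ := AddSubgroup.card_eq_card_quotient_mul_card_addSubgroup C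
    rw [card_amb, h.2.1, h.card] at h₁
    have hlt : t < 2 ^ t := Nat.lt_two_pow_self
    have h₂ : 2 ^ 2 ^ t = 2 * 2 ^ t * 2 ^ (2 ^ t - t - 1) := by
      rw [← pow_succ', ← pow_add]
      congr 1
      omega
    rw [hS]
    exact (Nat.eq_of_mul_eq_mul_right (by positivity) (h₂.symm.trans h₁)).symm
  have hneg : ∀ s ∈ S, -s ∈ S := by
    rintro _ ⟨i, rfl⟩
    obtain ⟨k, hk⟩ := exists_unitVec_eq_neg i
    exact ⟨k, by simp only [hk, map_neg]⟩
  have hsum : ∀ s ∈ S, ∀ s' ∈ S, s + s' ∉ S := by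
    rintro _ ⟨i, rfl⟩ _ ⟨k, rfl⟩ ⟨l, hl⟩
    have hmem : (unitVec i + unitVec k + -unitVec l : Amb α β) ∈ C := by
      rw [← hmk, map_add, map_add, map_neg, ← sub_eq_add_neg, sub_eq_zero]
      exact hl.symm
    have h₁ := leeWeight_add_le (unitVec i + unitVec k : Amb α β) (-unitVec l)
    have h₂ := leeWeight_add_le (unitVec i : Amb α β) (unitVec k)
    rw [leeWeight_neg, leeWeight_unitVec] at h₁
    rw [leeWeight_unitVec, leeWeight_unitVec] at h₂
    have h₃ := congrArg parity (h.eq_zero_of_leeWeight_lt hmem (by omega))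
    simp only [map_add, map_neg, parity_unitVec, map_zero] at h₃
    exact absurd h₃ (by decide)
  let A : Amb α β ⧸ C → Z2 := fun q => if q ∈ S then 1 else 0
  have hA : ∀ (i) (q), A (q + mk (unitVec i)) = A q + 1 := by
    intro i q
    have hiff := add_mem_iff_notMem_of_sumFree hcard hneg hsum ⟨i, rfl⟩ q
    by_cases hq : q ∈ S
    · simp only [A, hiff, hq, not_true, if_true, if_false]
      decide
    · simp only [A, hiff, hq, not_false_iff, if_true, if_false]
      decide
  let H : AddSubgroup (Amb α β) :=
    { carrier := {x | ∀ q, A (q + mk x) = A q + parity x}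
      zero_mem' := fun q => by simp
      add_mem' := by
        intro x y hx hy q
        rw [map_add, ← add_assoc, hy, hx, map_add, add_assoc]
      neg_mem' := by
        intro x hx q
        have := hx (q + mk (-x))
        rw [add_assoc, ← map_add, neg_add_cancel, map_zero, add_zero] at this
        rw [this, map_neg parity, add_neg_cancel_right] }
  have hH : ∀ x, x ∈ H := by
    refine addSubgroup_eq_top_of_units_mem H (fun i q => ?_) fun j q => ?_
    · rw [parity_binUnit]
      exact hA (Sum.inl i) q
    · rw [parity_quatUnit]
      exact hA (Sum.inr (j, true)) q
  intro c hc
  have := hH c 0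
  rw [(hmk c).mpr hc, add_zero, left_eq_add] at this
  exact this

end PerfectCode

section Duality

variable {t α β γ δ : ℕ} {C : AddSubgroup (Amb α β)}

lemma addInner_comm (u v : Amb α β) : addInner u v = addInner v u := by
  simp only [addInner, mul_comm]

/-- Pairing with a fixed vector, as a homomorphism. -/
def addInnerHom (u : Amb α β) : Amb α β →+ Z4 where
  toFun v := addInner u v
  map_zero' := by rw [addInner_comm, addInner_zero_left]
  map_add' v w := by
    rw [addInner_comm, addInner_add_left, addInner_comm v, addInner_comm w]

lemma addInner_quatUnit (u : Amb α β) (j : Fin β) : addInner u (quatUnit j) = u.2 j := by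
  simp [addInner, quatUnit, Pi.single_apply]

lemma addInner_binUnit (u : Amb α β) (i : Fin α) :
    addInner u (binUnit i) = 2 * ((u.1 i).val : Z4) := by
  have : ∀ k, (((Pi.single i 1 : Fin α → Z2) k).val : Z4) = if k = i then 1 else 0 := by
    intro k
    rw [Pi.single_apply]
    split_ifs <;> rfl
  simp [addInner, binUnit, this]

/-- The pairing is perfect: every homomorphism to `Z₄` is pairing with some vector. -/
lemma exists_addInner_eq (f : Amb α β →+ Z4) : ∃ u, ∀ v, addInner u v = f v := by
  have hlift : ∀ a : Z4, a + a = 0 → ∃ b : Z2, 2 * (b.val : Z4) = a := by decide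
  have hbin : ∀ i, f (binUnit i) + f (binUnit i) = 0 := by
    intro i
    have h2 : ∀ a : Z2, a + a = 0 := by decide
    rw [← map_add, show (binUnit i + binUnit i : Amb α β) = 0 from
      Prod.ext (funext fun k => h2 _) (by simp [binUnit]), map_zero]
  choose b hb using fun i => hlift _ (hbin i)
  refine ⟨(b, fun j => f (quatUnit j)), ?_⟩
  refine addSubgroup_eq_top_of_units_mem ((addInnerHom _).eqLocus f) (fun i => ?_) fun j => ?_
  · exact (addInner_binUnit _ i).trans (hb i)
  · exact addInner_quatUnit _ j

instance : HasEnoughRootsOfUnity (Multiplicative Z4) 4 where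
  prim := ⟨Multiplicative.ofAdd 1, by
    rw [IsPrimitiveRoot.iff_def]
    refine ⟨by decide, fun l hl => ?_⟩
    rw [← ofAdd_nsmul, nsmul_one] at hl
    exact (ZMod.natCast_eq_zero_iff l 4).mp hl⟩
  cyc := by
    have : IsCyclic (Multiplicative Z4)ˣ :=
      isCyclic_of_surjective (toUnits (G := Multiplicative Z4)) toUnits.surjective
    infer_instance

/-- A vector orthogonal to the dual of a code lies in the code. -/
lemma mem_of_forall_dualCode {x : Amb α β} (hx : ∀ u ∈ dualCode C, addInner u x = 0) : x ∈ C := by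
  have hexp : Monoid.exponent (Multiplicative (Amb α β)) ∣ 4 := by
    refine Monoid.exponent_dvd_of_forall_pow_eq_one fun g => ?_
    have h2 : ∀ a : Z2, 4 • a = 0 := by decide
    have h4 : ∀ a : Z4, 4 • a = 0 := by decide
    exact Prod.ext (funext fun i => h2 _) (funext fun j => h4 _)
  have := HasEnoughRootsOfUnity.of_dvd (Multiplicative Z4) hexp
  refine (CommGroup.forall_monoidHom_apply_eq_one_iff (M := Multiplicative Z4)
    (AddSubgroup.toSubgroup C) (Multiplicative.ofAdd x)).mp fun φ hφ => ?_
  let f : Amb α β →+ Z4 := AddMonoidHom.toMultiplicative.symm ((Units.coeHom _).comp φ)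
  obtain ⟨u, hu⟩ := exists_addInner_eq f
  have hmem : u ∈ dualCode C := by
    intro v hv
    rw [hu]
    have := hφ (Multiplicative.ofAdd v) hv
    change Multiplicative.toAdd ((φ (Multiplicative.ofAdd v) : Multiplicative Z4)) = 0
    rw [this]
    rfl
  have h0 := hx u hmem
  rw [hu] at h0
  exact Units.ext h0

/-- If the 2-torsion of a finite group has index two, then all doubles of elements
outside of it coincide. -/
lemma isOfType.add_self_eq (h : isOfType C γ 1) {u v : Amb α β} (hu : u ∈ C) (hv : v ∈ C)
    (hu' : u + u ≠ 0) (hv' : v + v ≠ 0) : u + u = v + v := by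
  let T : AddSubgroup C := (nsmulAddMonoidHom 2 : C →+ C).ker
  have hT : ∀ x : C, x ∈ T ↔ (x : Amb α β) + x = 0 := by
    intro x
    rw [AddMonoidHom.mem_ker, nsmulAddMonoidHom_apply, two_nsmul, ← AddSubgroup.coe_add,
      ZeroMemClass.coe_eq_zero]
  have hcardT : Nat.card T = 2 ^ (γ + 1) := by
    rw [← h.2]
    exact Nat.card_congr
      { toFun := fun x => ⟨x.1.1, x.1.2, (hT x.1).mp x.2⟩
        invFun := fun x => ⟨⟨x.1, x.2.1⟩, (hT _).mpr x.2.2⟩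
        left_inv := fun x => rfl
        right_inv := fun x => rfl }
  have hindex : T.index = 2 := by
    have := T.card_mul_index
    rw [hcardT, h.1, show γ + 2 * 1 = γ + 1 + 1 by ring, pow_succ 2 (γ + 1)] at this
    exact Nat.eq_of_mul_eq_mul_left (by positivity) this
  have hmem : (⟨u, hu⟩ + -⟨v, hv⟩ : C) ∈ T := by
    rw [AddSubgroup.add_mem_iff_of_index_two hindex, neg_mem_iff, hT, hT]
    exact iff_of_false hu' hv'
  rw [hT] at hmem
  have h' : u + -v + (u + -v) = 0 := hmem
  rw [← sub_eq_zero, ← h']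
  abel

lemma exists_dualCode_add_self_apply_ne_zero (h : isAddExtPerfect t α β C) (j : Fin β) :
    ∃ u ∈ dualCode C, (u + u).2 j ≠ 0 := by
  by_contra! hall
  have hmem : (quatUnit j + quatUnit j : Amb α β) ∈ C := by
    refine mem_of_forall_dualCode fun u hu => ?_
    rw [← hall u hu]
    change addInnerHom u _ = _
    rw [map_add]
    change addInner u (quatUnit j) + addInner u (quatUnit j) = _
    rw [addInner_quatUnit]
    rfl
  have hw := leeWeight_add_le (quatUnit j : Amb α β) (quatUnit j)
  rw [leeWeight_quatUnit] at hw
  have h0 := congrFun (congrArg Prod.snd (h.eq_zero_of_leeWeight_lt hmem (by omega))) j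
  simp only [quatUnit, Prod.snd_add, Pi.add_apply, Pi.single_eq_same, Prod.snd_zero,
    Pi.zero_apply] at h0
  exact absurd h0 (by decide)

lemma isOfType.exists_add_self_ne_zero (h : isOfType C γ 1) : ∃ u ∈ C, u + u ≠ 0 := by
  by_contra! hall
  have hcard : Nat.card {x : Amb α β // x ∈ C ∧ x + x = 0} = Nat.card C :=
    Nat.card_congr (Equiv.subtypeEquivRight fun x => ⟨And.left, fun hx => ⟨hx, hall x hx⟩⟩)
  rw [h.1, h.2] at hcard
  have := Nat.pow_right_injective le_rfl hcard
  omega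

lemma isAddExtPerfect.le_ker_quatParity (h : isAddExtPerfect t α β C)
    (hd : isOfType (dualCode C) γ 1) : C ≤ quatParity.ker := by
  obtain ⟨u, hu, hu'⟩ := hd.exists_add_self_ne_zero
  have hall : ∀ j, u.2 j + u.2 j = 2 := by
    intro j
    obtain ⟨w, hw, hw'⟩ := exists_dualCode_add_self_apply_ne_zero h j
    have he := hd.add_self_eq hu hw hu' fun h0 => hw' (by rw [h0]; rfl)
    rw [← he] at hw'
    have key : ∀ a : Z4, a + a ≠ 0 → a + a = 2 := by decide
    exact key _ hw'
  intro c hc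
  have h0 := (dualCode C).add_mem hu hu c hc
  rw [addInner_add_left, addInner, ← two_mul, mul_add, ← mul_assoc,
    show (2 * 2 : Z4) = 0 from by decide, zero_mul, zero_add, Finset.mul_sum,
    Finset.sum_congr rfl fun j _ => show 2 * (u.2 j * c.2 j) = 2 * c.2 j by
      rw [← mul_assoc, two_mul, hall], ← Finset.mul_sum] at h0
  have key : ∀ a : Z4, 2 * a = 0 → ZMod.castHom (by norm_num : 2 ∣ 4) Z2 a = 0 := by decide
  have := key _ h0
  rwa [map_sum] at this

end Duality

section Intersection

/-- Two subgroups contained in the kernel of a surjection intersect in a large subgroup. -/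
lemma card_mul_card_mul_card_le_of_le_ker {G A : Type*} [AddCommGroup G] [Finite G] [AddGroup A]
    (f : G →+ A) (hf : Function.Surjective f) {H K : AddSubgroup G}
    (hH : H ≤ f.ker) (hK : K ≤ f.ker) :
    Nat.card H * Nat.card K * Nat.card A ≤ Nat.card G * Nat.card ↥(H ⊓ K) := by
  have h₁ : Nat.card ↥(H ⊓ K) * K.relIndex H = Nat.card H := by
    have h := AddSubgroup.relIndex_mul_relIndex ⊥ (H ⊓ K) H bot_le inf_le_left
    rwa [AddSubgroup.relIndex_bot_left, AddSubgroup.relIndex_bot_left,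
      AddSubgroup.inf_relIndex_left] at h
  have h₂ : Nat.card K * K.relIndex f.ker = Nat.card f.ker := by
    have h := AddSubgroup.relIndex_mul_relIndex ⊥ K f.ker bot_le hK
    rwa [AddSubgroup.relIndex_bot_left, AddSubgroup.relIndex_bot_left] at h
  have h₃ : Nat.card f.ker * Nat.card A = Nat.card G := by
    rw [← f.ker.card_mul_index, AddSubgroup.index_ker, AddMonoidHom.range_eq_top.mpr hf,
      Nat.card_congr AddSubgroup.topEquiv.toEquiv]
  have h₄ : K.relIndex H ≤ K.relIndex f.ker :=
    AddSubgroup.relIndex_le_of_le_right hH fun h0 => by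
      rw [h0, mul_zero] at h₂
      exact Nat.card_pos.ne h₂
  calc Nat.card H * Nat.card K * Nat.card A
      = Nat.card ↥(H ⊓ K) * Nat.card K * Nat.card A * K.relIndex H := by rw [← h₁]; ring
    _ ≤ Nat.card ↥(H ⊓ K) * Nat.card K * Nat.card A * K.relIndex f.ker := by gcongr
    _ = Nat.card G * Nat.card ↥(H ⊓ K) := by rw [← h₃, ← h₂]; ring

variable {t α β : ℕ} {C₁ C₂ : AddSubgroup (Amb α β)}

lemma isAddExtPerfect.two_pow_le_card_inf (h₁ : isAddExtPerfect t α β C₁)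
    (h₂ : isAddExtPerfect t α β C₂) {A : Type*} [AddGroup A] {k : ℕ} (hA : Nat.card A = 2 ^ k)
    (f : Amb α β →+ A) (hf : Function.Surjective f) (hC₁ : C₁ ≤ f.ker) (hC₂ : C₂ ≤ f.ker) :
    2 ^ (2 ^ t - t - 1 + (2 ^ t - t - 1) + k - 2 ^ t) ≤ Nat.card ↥(C₁ ⊓ C₂) := by
  have h := card_mul_card_mul_card_le_of_le_ker f hf hC₁ hC₂
  rw [h₁.card, h₂.card, hA, card_amb, h₁.2.1, ← pow_add, ← pow_add] at h
  rcases le_total (2 ^ t) (2 ^ t - t - 1 + (2 ^ t - t - 1) + k) with hle | hle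
  · refine le_of_mul_le_mul_left (a := 2 ^ 2 ^ t) ?_ (Nat.two_pow_pos _)
    rwa [← pow_add, Nat.add_sub_cancel' hle]
  · rw [Nat.sub_eq_zero_of_le hle, pow_zero]
    exact Nat.card_pos

end Intersection

/-- intersection-number bounds for additive extended perfect codes with
`α ≠ 0`, both of dual type `(α,β;γ,δ)`. -/
theorem stmt18 {t α β γ δ : ℕ} (ht : 3 ≤ t)
    (C₁ C₂ : AddSubgroup (Amb α β))
    (h₁ : isAddExtPerfect t α β C₁) (h₂ : isAddExtPerfect t α β C₂)
    (hd₁ : isOfType (dualCode C₁) γ δ) (hd₂ : isOfType (dualCode C₂) γ δ) :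
    (δ = 1 → 2 ^ (2 ^ t - 2 * t) ≤ Nat.card ↥(C₁ ⊓ C₂) ∧
      Nat.card ↥(C₁ ⊓ C₂) ≤ 2 ^ (2 ^ t - t - 1)) ∧
    (δ ≠ 1 → 2 ^ (2 ^ t - 2 * t - 1) ≤ Nat.card ↥(C₁ ⊓ C₂) ∧
      Nat.card ↥(C₁ ⊓ C₂) ≤ 2 ^ (2 ^ t - t - 1)) := by
  have hupper : Nat.card ↥(C₁ ⊓ C₂) ≤ 2 ^ (2 ^ t - t - 1) :=
    h₁.card ▸ AddSubgroup.card_le_of_le inf_le_left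
  have ht' : t < 2 ^ t := Nat.lt_two_pow_self
  have i₀ : Fin α := ⟨0, h₁.1⟩
  refine ⟨?_, fun _ => ⟨?_, hupper⟩⟩
  · rintro rfl
    refine ⟨?_, hupper⟩
    obtain ⟨j₀⟩ : Nonempty (Fin β) := by
      obtain ⟨u, -, hu⟩ := hd₁.exists_add_self_ne_zero
      rcases Nat.eq_zero_or_pos β with rfl | hβ
      · have h2 : ∀ a : Z2, a + a = 0 := by decide
        exact absurd (Prod.ext (funext fun i => h2 _) (Subsingleton.elim _ _)) hu
      · exact ⟨⟨0, hβ⟩⟩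
    have hsurj : Function.Surjective (parity.prod quatParity : Amb α β →+ Z2 × Z2) := by
      rintro ⟨a, b⟩
      refine ⟨(a - b).val • binUnit i₀ + b.val • quatUnit j₀, ?_⟩
      simp [-nsmul_eq_mul, nsmul_one]
    refine le_trans (Nat.pow_le_pow_right two_pos ?_)
      (h₁.two_pow_le_card_inf (k := 2) h₂ (by simp) _ hsurj ?_ ?_)
    · omega
    · rw [AddMonoidHom.ker_prod]
      exact le_inf h₁.le_ker_parity (h₁.le_ker_quatParity hd₁)
    · rw [AddMonoidHom.ker_prod]
      exact le_inf h₂.le_ker_parity (h₂.le_ker_quatParity hd₂)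
  · have hsurj : Function.Surjective (parity : Amb α β →+ Z2) := fun a =>
      ⟨a.val • binUnit i₀, by simp [-nsmul_eq_mul, nsmul_one]⟩
    refine le_trans (Nat.pow_le_pow_right two_pos ?_)
      (h₁.two_pow_le_card_inf (k := 1) h₂ (by simp) _ hsurj h₁.le_ker_parity h₂.le_ker_parity)
    omega
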